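/- For every natural number n with 2 ≤ n ≤ 21, the relational structure K has an n-ary cyclic polymorphism: there exists f : (Fin n → K) → K with f(x ∘ c) = f(x) for all x : Fin n → K, where c is the cyclic shift permutation of Fin n, and with f(r ∘ x) = r(f(x)) and f(s ∘ x) = s(f(x)) for all x : Fin n → K. -/

import Mathlib

/-- The 21-element universe of the relational structure `K`. -/
inductive K : Type
  | k0 | k1 | k2 | k3 | k4 | k5 | k6 | k7 | k8 | k9 | k10
  | p01 | p02 | p03 | p04 | p12 | p13 | p14 | p23 | p24 | p34
  deriving DecidableEq

open K

/-- The permutation `r = (0 1 2)(5 6 7)(8 9 10)(p12 p02 p01)(p04 p14 p24)(p13 p23 p03)`. -/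
def r : K → K
  | k0 => k1 | k1 => k2 | k2 => k0
  | k3 => k3 | k4 => k4
  | k5 => k6 | k6 => k7 | k7 => k5
  | k8 => k9 | k9 => k10 | k10 => k8
  | p12 => p02 | p02 => p01 | p01 => p12
  | p04 => p14 | p14 => p24 | p24 => p04
  | p13 => p23 | p23 => p03 | p03 => p13
  | p34 => p34

/-- The permutation `s = (1 4)(2 3)(5 6)(7 8)(p34 p12)(p02 p03)(p01 p04)(p24 p13)`. -/
def s : K → K
  | k0 => k0
  | k1 => k4 | k4 => k1
  | k2 => k3 | k3 => k2
  | k5 => k6 | k6 => k5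
  | k7 => k8 | k8 => k7
  | k9 => k9 | k10 => k10
  | p34 => p12 | p12 => p34
  | p02 => p03 | p03 => p02
  | p01 => p04 | p04 => p01
  | p24 => p13 | p13 => p24
  | p14 => p14 | p23 => p23

namespace K

/-- The elements of `K`, listed. -/
def elems : List K :=
  [k0, k1, k2, k3, k4, k5, k6, k7, k8, k9, k10, p01, p02, p03, p04, p12, p13, p14, p23, p24, p34]

theorem mem_elems (a : K) : a ∈ elems := by cases a <;> decide

instance : Fintype K := ⟨⟨elems, by decide⟩, mem_elems⟩

/-- The three orbits: the points `0, …, 4`, the points `5, …, 10`, and the pairs. -/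
def orbitIndex : K → Fin 3
  | k0 | k1 | k2 | k3 | k4 => 0
  | k5 | k6 | k7 | k8 | k9 | k10 => 1
  | _ => 2

theorem orbitIndex_r (a : K) : orbitIndex (r a) = orbitIndex a := by cases a <;> rfl

theorem orbitIndex_s (a : K) : orbitIndex (s a) = orbitIndex a := by cases a <;> rfl

/-- The permutation `r` as an element of the symmetric group. -/
def rPerm : Equiv.Perm K := ⟨r, r ∘ r, by decide, by decide⟩

/-- The permutation `s` as an element of the symmetric group. -/
def sPerm : Equiv.Perm K := ⟨s, s, by decide, by decide⟩

/-- The group generated by `r` and `s`. -/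
def G : Subgroup (Equiv.Perm K) := Subgroup.closure {rPerm, sPerm}

theorem rPerm_mem : rPerm ∈ G := Subgroup.subset_closure (by simp)

theorem sPerm_mem : sPerm ∈ G := Subgroup.subset_closure (by simp)

/-- The table of values of a map `K → K`. -/
def table (f : K → K) : List K := elems.map f

/-- The tables of values of the elements of `G`. -/
def tables : List (List K) :=
  let t := s ∘ r
  let v := s ∘ r ∘ r ∘ s ∘ r ∘ s
  (do
    let a ← [id, t, t ∘ t, t ∘ t ∘ t, t ∘ t ∘ t ∘ t]
    let b ← [id, r, r ∘ r]
    let c ← [id, v ∘ r]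
    let d ← [id, v]
    return table (a ∘ b ∘ c ∘ d))

theorem table_injective : Function.Injective table := by
  intro f g h
  funext a
  exact List.map_inj_left.1 h a (mem_elems a)

theorem table_comp (f g : K → K) : table (f ∘ g) = (table g).map f := by
  simp [table]

theorem tables_closed :
    ∀ l ∈ tables, l.map r ∈ tables ∧ l.map s ∈ tables := by
  decide +kernel

theorem table_mem_tables {g : Equiv.Perm K} (hg : g ∈ G) : table g ∈ tables := by
  have hr : ∀ f : Equiv.Perm K, table f ∈ tables → table (rPerm * f : Equiv.Perm K) ∈ tables := by
    intro f hf
    rw [Equiv.Perm.coe_mul, table_comp]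
    exact (tables_closed _ hf).1
  have hs : ∀ f : Equiv.Perm K, table f ∈ tables → table (sPerm * f : Equiv.Perm K) ∈ tables := by
    intro f hf
    rw [Equiv.Perm.coe_mul, table_comp]
    exact (tables_closed _ hf).2
  have hr' : rPerm⁻¹ = rPerm * rPerm := by ext a; cases a <;> rfl
  have hs' : sPerm⁻¹ = sPerm := rfl
  induction hg using Subgroup.closure_induction_left with
  | one => decide +kernel
  | mul_left x hx y _ ih =>
    rcases hx with rfl | rfl
    exacts [hr _ ih, hs _ ih]
  | inv_mul_cancel x hx y _ ih =>
    rcases hx with rfl | rfl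
    · rw [hr', mul_assoc]
      exact hr _ (hr _ ih)
    · rw [hs']
      exact hs _ ih

theorem orbitIndex_apply {g : Equiv.Perm K} (hg : g ∈ G) (a : K) :
    orbitIndex (g a) = orbitIndex a := by
  induction hg using Subgroup.closure_induction generalizing a with
  | mem x hx =>
    rcases hx with rfl | rfl
    exacts [orbitIndex_r a, orbitIndex_s a]
  | one => rfl
  | mul x y _ _ ihx ihy => rw [Equiv.Perm.mul_apply, ihx, ihy]
  | inv x _ ih => rw [← ih, Equiv.Perm.inv_def, Equiv.apply_symm_apply]

/-- The points fixed by the map with the given table of values. -/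
def fixedPoints (l : List K) : List K :=
  ((elems.zip l).filter fun p => p.1 = p.2).map Prod.fst

theorem mem_fixedPoints_table {f : K → K} {a : K} : a ∈ fixedPoints (table f) ↔ f a = a := by
  have : elems.zip (table f) = elems.map fun a => (a, f a) := by
    rw [table, List.zip_map_right, List.zip_eq_zipWith, List.zipWith_self, List.map_map]
    rfl
  simp only [fixedPoints, this, List.mem_map, List.mem_filter]
  simp [mem_elems, eq_comm]

/-- The fixed point sets of the nontrivial elements of `G`: those of the elements of order five,
three and two, in this order. -/
def fixedSets : List (List K) :=
  [[k5], [k6], [k7], [k8], [k9], [k10], [k0, k1, p01], [k0, k2, p02], [k0, k3, p03],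
   [k0, k4, p04], [k1, k2, p12], [k1, k3, p13], [k1, k4, p14], [k2, k3, p23], [k2, k4, p24],
   [k3, k4, p34], [k0, k5, k6, p13, p24], [k0, k7, k8, p12, p34], [k0, k9, k10, p14, p23],
   [k1, k5, k9, p02, p34], [k1, k6, k7, p04, p23], [k1, k8, k10, p03, p24],
   [k2, k5, k7, p03, p14], [k2, k6, k10, p01, p34], [k2, k8, k9, p04, p13],
   [k3, k5, k10, p04, p12], [k3, k6, k8, p02, p14], [k3, k7, k9, p01, p24],
   [k4, k5, k8, p01, p23], [k4, k6, k9, p03, p12], [k4, k7, k10, p02, p13]]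

theorem fixedPoints_mem_fixedSets : ∀ l ∈ tables, l = elems ∨ fixedPoints l ∈ fixedSets := by
  decide +kernel

theorem fixedSets_unique_in_orbit :
    ∀ m ∈ fixedSets, ∃ a ∈ m, ∀ b ∈ m, orbitIndex b = orbitIndex a → b = a := by
  decide +kernel

theorem fixedSets_inter :
    ∀ m ∈ fixedSets, ∀ m' ∈ fixedSets, m = m' ∨ ∀ a ∈ m, a ∈ m' → ∀ b ∈ m, b ∈ m' → a = b := by
  decide +kernel

theorem fixedPoints_table_mem {g : Equiv.Perm K} (hg : g ∈ G) (h1 : g ≠ 1) :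
    fixedPoints (table g) ∈ fixedSets := by
  refine (fixedPoints_mem_fixedSets _ (table_mem_tables hg)).resolve_left fun h => h1 ?_
  exact DFunLike.coe_injective <| table_injective <| by simpa [table] using h

theorem exists_unique_in_orbit {g : Equiv.Perm K} (hg : g ∈ G) (h1 : g ≠ 1) :
    ∃ a, g a = a ∧ ∀ b, g b = b → orbitIndex b = orbitIndex a → b = a := by
  simpa only [mem_fixedPoints_table] using
    fixedSets_unique_in_orbit _ (fixedPoints_table_mem hg h1)

theorem fixed_subset_or_subsingleton {g h : Equiv.Perm K} (hg : g ∈ G) (h1 : g ≠ 1) (hh : h ∈ G) :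
    (∀ a, g a = a → h a = a) ∨ ∀ a, g a = a → h a = a → ∀ b, g b = b → h b = b → a = b := by
  by_cases h1' : h = 1
  · exact .inl fun a _ => by rw [h1']; rfl
  · rcases fixedSets_inter _ (fixedPoints_table_mem hg h1) _ (fixedPoints_table_mem hh h1') with
      H | H
    · exact .inl fun a ha => mem_fixedPoints_table.1 (H ▸ mem_fixedPoints_table.2 ha)
    · exact .inr (by simpa only [mem_fixedPoints_table] using H)

/-- If a subgroup `H` of `G` normalizes a nontrivial subset `T` of `G` that has a common fixed
point, then `H` has a fixed point. -/
theorem exists_fixed_of_normalizes {H : Subgroup (Equiv.Perm K)} (hH : H ≤ G)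
    {T : Set (Equiv.Perm K)} (hTG : T ⊆ G) (hT : ∀ h ∈ H, ∀ t ∈ T, h⁻¹ * t * h ∈ T)
    {g : Equiv.Perm K} (hg : g ∈ T) (h1 : g ≠ 1) {p : K} (hp : ∀ t ∈ T, t p = p) :
    ∃ y, ∀ h ∈ H, h y = y := by
  have invariant : ∀ h ∈ H, ∀ a, (∀ t ∈ T, t a = a) → ∀ t ∈ T, t (h a) = h a := by
    intro h hh a ha t ht
    have := ha _ (hT h hh t ht)
    rwa [Equiv.Perm.mul_apply, Equiv.Perm.mul_apply, Equiv.Perm.inv_eq_iff_eq] at this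
  by_cases hsub : ∀ t ∈ T, ∀ a, g a = a → t a = a
  · obtain ⟨a, ha, hu⟩ := exists_unique_in_orbit (hTG hg) h1
    refine ⟨a, fun h hh => hu _ ?_ (orbitIndex_apply (hH hh) a)⟩
    exact invariant h hh a (fun t ht => hsub t ht a ha) g hg
  · push Not at hsub
    obtain ⟨t, ht, a, ha, hta⟩ := hsub
    have key := (fixed_subset_or_subsingleton (hTG hg) h1 (hTG ht)).resolve_left
      fun h => hta (h a ha)
    exact ⟨p, fun h hh => key _ (invariant h hh p hp g hg) (invariant h hh p hp t ht) _
      (hp g hg) (hp t ht)⟩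

/-- A subgroup of `G` that acts on some nonempty invariant set through a commutative quotient has
a fixed point. -/
theorem exists_fixed_of_commute_on {H : Subgroup (Equiv.Perm K)} (hH : H ≤ G) {X : Set K}
    (hne : X.Nonempty) (hX : ∀ h ∈ H, ∀ a ∈ X, h a ∈ X)
    (hcomm : ∀ g ∈ H, ∀ h ∈ H, ∀ a ∈ X, g (h a) = h (g a)) :
    ∃ y, ∀ h ∈ H, h y = y := by
  obtain ⟨p, hp⟩ := hne
  by_cases hfaithful : ∃ g ∈ H, (∀ a ∈ X, g a = a) ∧ g ≠ 1
  · obtain ⟨g, hg, hgX, h1⟩ := hfaithful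
    refine exists_fixed_of_normalizes (T := {t | t ∈ H ∧ ∀ a ∈ X, t a = a}) hH
      (fun t ht => hH ht.1) ?_ ⟨hg, hgX⟩ h1 fun t ht => ht.2 p hp
    rintro h hh t ⟨ht, htX⟩
    refine ⟨H.mul_mem (H.mul_mem (H.inv_mem hh) ht) hh, fun a ha => ?_⟩
    rw [Equiv.Perm.mul_apply, Equiv.Perm.mul_apply, htX _ (hX h hh a ha),
      Equiv.Perm.inv_def, Equiv.symm_apply_apply]
  · push Not at hfaithful
    by_cases htriv : ∃ g ∈ H, g ≠ 1
    · obtain ⟨g, hg, h1⟩ := htriv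
      obtain ⟨a, ha, -⟩ := exists_unique_in_orbit (hH hg) h1
      refine exists_fixed_of_normalizes (T := {g}) (p := a) hH
        (Set.singleton_subset_iff.2 (hH hg)) ?_ rfl h1 (by simpa using ha)
      rintro h hh _ rfl
      rename_i g
      have : (h * g)⁻¹ * (g * h) = 1 := by
        refine hfaithful _ (H.mul_mem (H.inv_mem (H.mul_mem hh hg)) (H.mul_mem hg hh)) fun b hb => ?_
        rw [Equiv.Perm.mul_apply, Equiv.Perm.inv_eq_iff_eq]
        exact hcomm g hg h hh b hb
      rw [inv_mul_eq_one] at this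
      rw [Set.mem_singleton_iff, mul_assoc, ← this, inv_mul_cancel_left]
    · push Not at htriv
      exact ⟨p, fun h hh => by rw [htriv h hh]; rfl⟩

section Equivariant

variable {ι : Type*} (c : Equiv.Perm ι)

/-- The elements of `G` whose action on the tuple `x` is a power of the coordinate
permutation `c`. -/
def shiftStabilizer (x : ι → K) : Subgroup (Equiv.Perm K) where
  carrier := {g | g ∈ G ∧ ∃ k : ℤ, g ∘ x = x ∘ (c ^ k : Equiv.Perm ι)}
  one_mem' := ⟨G.one_mem, 0, rfl⟩
  mul_mem' := by
    rintro g h ⟨hg, k, hk⟩ ⟨hh, l, hl⟩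
    refine ⟨G.mul_mem hg hh, k + l, ?_⟩
    rw [Equiv.Perm.coe_mul, Function.comp_assoc, hl, ← Function.comp_assoc, hk, zpow_add,
      Equiv.Perm.coe_mul, Function.comp_assoc]
  inv_mem' := by
    rintro g ⟨hg, k, hk⟩
    refine ⟨G.inv_mem hg, -k, funext fun i => ?_⟩
    have := congrFun hk ((c ^ (-k) : Equiv.Perm ι) i)
    simp only [Function.comp_apply, zpow_neg, Equiv.Perm.inv_def, Equiv.apply_symm_apply] at this
    rw [Function.comp_apply, Equiv.Perm.inv_eq_iff_eq, ← this, zpow_neg]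
    rfl

theorem exists_fixed_shiftStabilizer [Nonempty ι] (x : ι → K) :
    ∃ y, ∀ g ∈ shiftStabilizer c x, g y = y := by
  refine exists_fixed_of_commute_on (X := Set.range x) (fun g hg => hg.1)
    (Set.range_nonempty x) ?_ ?_
  · rintro g ⟨-, k, hk⟩ _ ⟨i, rfl⟩
    exact ⟨_, (congrFun hk i).symm⟩
  · rintro g ⟨-, k, hk⟩ h ⟨-, l, hl⟩ _ ⟨i, rfl⟩
    have hk' (j) : g (x j) = x ((c ^ k : Equiv.Perm ι) j) := congrFun hk j
    have hl' (j) : h (x j) = x ((c ^ l : Equiv.Perm ι) j) := congrFun hl j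
    rw [hl', hk', hk', hl', ← Equiv.Perm.mul_apply, ← Equiv.Perm.mul_apply, ← zpow_add,
      ← zpow_add, add_comm]

/-- Two tuples are related when an element of `G` together with a power of the coordinate
permutation `c` moves one to the other. -/
def shiftSetoid : Setoid (ι → K) where
  r x y := ∃ g ∈ G, ∃ k : ℤ, y = g ∘ x ∘ (c ^ k : Equiv.Perm ι)
  iseqv :=
    { refl := fun _ => ⟨1, G.one_mem, 0, rfl⟩
      symm := by
        rintro x _ ⟨g, hg, k, rfl⟩
        refine ⟨g⁻¹, G.inv_mem hg, -k, funext fun i => ?_⟩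
        simp
      trans := by
        rintro x _ _ ⟨g, hg, k, rfl⟩ ⟨h, hh, l, rfl⟩
        refine ⟨h * g, G.mul_mem hh hg, k + l, funext fun i => ?_⟩
        simp [zpow_add] }

/-- There is an operation on `K` that commutes with `G` and is invariant under the given
permutation of the coordinates. -/
theorem exists_invariant_polymorphism [Nonempty ι] :
    ∃ f : (ι → K) → K, (∀ x, f (x ∘ c) = f x) ∧ ∀ g ∈ G, ∀ x, f (g ∘ x) = g (f x) := by
  let rep (x : ι → K) : ι → K := (Quotient.mk (shiftSetoid c) x).out
  have rep_eq {x y} (h : shiftSetoid c x y) : rep x = rep y :=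
    congrArg Quotient.out (Quotient.sound (s := shiftSetoid c) h)
  have rel (x) : shiftSetoid c (rep x) x := Quotient.mk_out (s := shiftSetoid c) x
  choose g hg k hk using rel
  choose y hy using exists_fixed_shiftStabilizer c
  have main (x : ι → K) (h) (hh : h ∈ G) (l : ℤ) :
      g (h ∘ x ∘ (c ^ l : Equiv.Perm ι)) (y (rep (h ∘ x ∘ (c ^ l : Equiv.Perm ι)))) =
        h (g x (y (rep x))) := by
    set x' := h ∘ x ∘ (c ^ l : Equiv.Perm ι) with hx'
    have e : rep x' = rep x := (rep_eq ⟨h, hh, l, rfl⟩).symm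
    have hk' := hk x'
    rw [e] at hk' ⊢
    have : (h * g x)⁻¹ * g x' ∈ shiftStabilizer c (rep x) := by
      refine ⟨G.mul_mem (G.inv_mem (G.mul_mem hh (hg x))) (hg x'), k x + l - k x',
        funext fun i => ?_⟩
      set j := (c ^ (-k x') : Equiv.Perm ι) i with hj
      have hi : i = (c ^ k x' : Equiv.Perm ι) j := by simp [hj]
      have h₁ : x' j = g x' (rep x i) := by rw [hi]; exact congrFun hk' j
      have h₂ : x' j = h (g x (rep x ((c ^ (k x + l) : Equiv.Perm ι) j))) := by
        rw [zpow_add]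
        exact congrArg h (congrFun (hk x) _)
      have h₃ : (c ^ (k x + l) : Equiv.Perm ι) j = (c ^ (k x + l - k x') : Equiv.Perm ι) i := by
        rw [hj, ← Equiv.Perm.mul_apply, ← zpow_add, sub_eq_add_neg]
      rw [Function.comp_apply, Equiv.Perm.mul_apply, Equiv.Perm.inv_eq_iff_eq, ← h₁, h₂, h₃]
      rfl
    have := hy _ _ this
    rwa [Equiv.Perm.mul_apply, Equiv.Perm.inv_eq_iff_eq] at this
  refine ⟨fun x => g x (y (rep x)), fun x => ?_, fun h hh x => ?_⟩
  · simpa using main x 1 G.one_mem 1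
  · simpa using main x h hh 0

end Equivariant

end K

/-- For every `n` with `2 ≤ n ≤ 21`, the relational structure `K` has an `n`-ary
cyclic polymorphism. -/
theorem K_has_cyclic_polymorphisms_up_to_21 :
    ∀ n : ℕ, 2 ≤ n → n ≤ 21 → ∃ f : (Fin n → K) → K,
      (∀ x : Fin n → K, f (x ∘ finRotate n) = f x) ∧
      (∀ x : Fin n → K, f (r ∘ x) = r (f x)) ∧
      (∀ x : Fin n → K, f (s ∘ x) = s (f x)) := by
  intro n hn _
  have : NeZero n := ⟨by lia⟩
  obtain ⟨f, hc, hG⟩ := K.exists_invariant_polymorphism (finRotate n)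
  exact ⟨f, hc, hG _ K.rPerm_mem, hG _ K.sPerm_mem⟩
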